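/- arXiv:1006.0992 — 2 statements merged into one kernel-verified Lean document; each statement's English description precedes it below -/
import Mathlib

section
/- Abstract Lawvere Fixpoint Lemma: Let C be a category with a terminal object 1 and binary products, let A and V be objects of C, and let f : A × A ⟶ V be weakly point surjective, meaning that for every arrow p : A ⟶ V there exists x : 1 ⟶ A such that for all y : 1 ⟶ A one has p ∘ y = f ∘ ⟨x, y⟩. Then every endomorphism α : V ⟶ V has a fixpoint, i.e. there exists v : 1 ⟶ V with α ∘ v = v. -/
open CategoryTheory CategoryTheory.Limits

/-- Abstract Lawvere Fixpoint Lemma: in a category with a terminal object and binary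
products, if `f : A ⨯ A ⟶ V` is weakly point surjective then every endomorphism
`α : V ⟶ V` has a fixpoint `v : ⊤_ C ⟶ V` with `v ≫ α = v`. -/
theorem abstract_lawvere_fixpoint {C : Type*} [Category C]
    [HasTerminal C] [HasBinaryProducts C] (A V : C) (f : A ⨯ A ⟶ V)
    (hwps : ∀ p : A ⟶ V, ∃ x : ⊤_ C ⟶ A, ∀ y : ⊤_ C ⟶ A,
      y ≫ p = prod.lift x y ≫ f) :
    ∀ α : V ⟶ V, ∃ v : ⊤_ C ⟶ V, v ≫ α = v := by
  intro α
  obtain ⟨x, hx⟩ := hwps (diag A ≫ f ≫ α)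
  refine ⟨prod.lift x x ≫ f, ?_⟩
  rw [Category.assoc, ← prod.comp_diag x, Category.assoc, hx x, prod.comp_diag]
end

section
/- Composition Lemma: Let A, B, C be sets with relations R_ab ⊆ A × B and R_bc ⊆ B × C, and let P(B) and P(C) be collections of non-empty predicates on B and C respectively. Suppose: (1) R_ab is belief-complete with respect to P(B); (2) R_bc is assumption-complete with respect to P(C); and (3) for each p ∈ P(C), the predicate ⊞_bc p = {y ∈ B | ∀ z ∈ C, R_bc(y, z) ↔ p(z)} belongs to P(B). Then the composition R_ac = R_ab ; R_bc ⊆ A × C, defined by R_ac(x, z) ↔ ∃ y ∈ B, R_ab(x, y) ∧ R_bc(y, z), is assumption-complete with respect to P(C). -/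
/-- A relation `R : A → B → Prop` is assumption-complete with respect to a collection
`PB` of predicates on `B` if every `p ∈ PB` is assumed by some `x ∈ A`. -/
def AssumptionComplete {A B : Type*} (R : A → B → Prop) (PB : Set (Set B)) : Prop :=
  ∀ p ∈ PB, ∃ x : A, ∀ y : B, R x y ↔ y ∈ p

/-- A relation `R : A → B → Prop` is belief-complete with respect to `PB` if for every
`p ∈ PB` there is `x ∈ A` which believes `p` (`R x y → y ∈ p`) and with `R x`
non-empty. -/
def BeliefComplete {A B : Type*} (R : A → B → Prop) (PB : Set (Set B)) : Prop :=
  ∀ p ∈ PB, ∃ x : A, (∀ y : B, R x y → y ∈ p) ∧ (∃ y : B, R x y)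

/-- Composition Lemma: if `Rab` is belief-complete w.r.t. `PB`, `Rbc` is
assumption-complete w.r.t. `PC`, and for each `p ∈ PC` the predicate
`⊞_bc p = {y | ∀ z, Rbc y z ↔ z ∈ p}` belongs to `PB`, then the relational composition
`Rab ; Rbc` is assumption-complete w.r.t. `PC`. -/
theorem composition_lemma {A B C : Type*} (Rab : A → B → Prop) (Rbc : B → C → Prop)
    (PB : Set (Set B)) (PC : Set (Set C))
    (hPB : ∀ p ∈ PB, p.Nonempty) (hPC : ∀ p ∈ PC, p.Nonempty)
    (h1 : BeliefComplete Rab PB)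
    (h2 : AssumptionComplete Rbc PC)
    (h3 : ∀ p ∈ PC, {y : B | ∀ z : C, Rbc y z ↔ z ∈ p} ∈ PB) :
    AssumptionComplete (fun (x : A) (z : C) => ∃ y : B, Rab x y ∧ Rbc y z) PC := by
  intro p hp
  obtain ⟨x, hx, y, hxy⟩ := h1 _ (h3 p hp)
  exact ⟨x, fun z => ⟨fun ⟨y', hxy', hyz⟩ => (hx y' hxy' z).mp hyz,
    fun hz => ⟨y, hxy, (hx y hxy z).mpr hz⟩⟩⟩
end
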